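/- A channel ν from A to B is R-AMS with respect to every stationary source if and only if for every probability measure μ on A that is stationary under T_A there exists a channel ν̄ from A to B such that the hookup μν̄ is stationary under T_{AB} and ν(x,·) is absolutely continuous with respect to ν̄(x,·) for μ-almost every x. -/

import Mathlib

open MeasureTheory ProbabilityTheory Filter

/-- A probability measure `η` is stationary under `T` if `η (T ⁻¹' F) = η F`
for all measurable `F`. -/
def Stationary {α : Type*} [MeasurableSpace α] (T : α → α)
    (η : MeasureTheory.Measure α) : Prop :=
  ∀ F : Set α, MeasurableSet F → η (T ⁻¹' F) = η F

/-- A probability measure `η` is recurrent under `T` if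
`η (F \ ⋃_{k ≥ 1} T^{-k} F) = 0` for all measurable `F`. -/
def Recurrent {α : Type*} [MeasurableSpace α] (T : α → α)
    (η : MeasureTheory.Measure α) : Prop :=
  ∀ F : Set α, MeasurableSet F → η (F \ ⋃ k : ℕ, (T^[k + 1]) ⁻¹' F) = 0

/-- A probability measure `η` is asymptotically mean stationary (AMS) under `T` if the
Cesàro averages `(1/n) ∑_{k<n} η (T^{-k} F)` converge for every measurable `F`. -/
def IsAMS {α : Type*} [MeasurableSpace α] (T : α → α)
    (η : MeasureTheory.Measure α) : Prop :=
  ∀ F : Set α, MeasurableSet F → ∃ L : ℝ,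
    Filter.Tendsto
      (fun n : ℕ => (∑ k ∈ Finset.range n, (η ((T^[k]) ⁻¹' F)).toReal) / (n : ℝ))
      Filter.atTop (nhds L)

/-- `η'` is the stationary mean of `η` under `T`: the Cesàro averages
`(1/n) ∑_{k<n} η (T^{-k} F)` converge to `η' F` for every measurable `F`. -/
def IsStationaryMean {α : Type*} [MeasurableSpace α] (T : α → α)
    (η η' : MeasureTheory.Measure α) : Prop :=
  ∀ F : Set α, MeasurableSet F →
    Filter.Tendsto
      (fun n : ℕ => (∑ k ∈ Finset.range n, (η ((T^[k]) ⁻¹' F)).toReal) / (n : ℝ))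
      Filter.atTop (nhds ((η' F).toReal))

/-- A probability measure `η` is ergodic under `T` if every strictly invariant
measurable set has measure `0` or `1`. -/
def ErgodicShift {α : Type*} [MeasurableSpace α] (T : α → α)
    (η : MeasureTheory.Measure α) : Prop :=
  ∀ F : Set α, MeasurableSet F → T ⁻¹' F = F → η F = 0 ∨ η F = 1


/-- Uniform smallness of tails for a sequence of summable nonnegative sequences whose sums over
every subset of `ℕ` converge. -/
lemma exists_forall_tail_le_of_tendsto_tsum_ite {a : ℕ → ℕ → ℝ} (ha : ∀ n i, 0 ≤ a n i)
    (hs : ∀ n, Summable (a n))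
    (hL : ∀ S : ℕ → Bool, ∃ L : ℝ, Tendsto (fun n => ∑' i, if S i then a n i else 0) atTop (nhds L))
    {ε : ℝ} (hε : 0 < ε) :
    ∃ k N : ℕ, ∀ n ≥ k, ∀ M ≥ N, ∑' i, (if M ≤ i then a n i else 0) ≤ ε := by
  classical
  set g : ℕ → (ℕ → Bool) → ℝ := fun n S => ∑' i, if S i then a n i else 0 with hg
  have hsum (n : ℕ) (p : ℕ → Prop) [DecidablePred p] :
      Summable (fun i => if p i then a n i else 0) :=
    (hs n).of_nonneg_of_le (fun i => by split_ifs <;> simp [ha]) fun i => by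
      split_ifs <;> simp [ha]
  have hcont (n : ℕ) : Continuous (g n) := by
    refine continuous_tsum (fun i => ?_) (hs n) fun i S => ?_
    · exact (continuous_of_discreteTopology (f := fun b : Bool => if b then a n i else 0)).comp
        (continuous_apply i)
    · split_ifs <;> simp [abs_of_nonneg, ha]
  set E : ℕ → Set (ℕ → Bool) := fun k => ⋂ n ≥ k, {S | |g n S - g k S| ≤ ε / 4} with hE
  have hEc (k : ℕ) : IsClosed (E k) :=
    isClosed_biInter fun n _ =>
      isClosed_le ((hcont n).sub (hcont k)).abs continuous_const
  have hEU : ⋃ k, E k = Set.univ := by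
    refine Set.eq_univ_of_forall fun S => ?_
    obtain ⟨L, h⟩ := hL S
    obtain ⟨k, hk⟩ := Metric.cauchySeq_iff'.1 h.cauchySeq (ε / 4) (by positivity)
    refine Set.mem_iUnion.2 ⟨k, Set.mem_iInter₂.2 fun n hn => ?_⟩
    exact (hk n hn).le
  obtain ⟨k, S₀, hS₀⟩ := nonempty_interior_of_iUnion_of_closed hEc hEU
  obtain ⟨I, u, hu, hsub⟩ := isOpen_pi_iff.1 isOpen_interior S₀ hS₀
  have hmem {S : ℕ → Bool} (h : ∀ i ∈ I, S i = S₀ i) : S ∈ E k :=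
    interior_subset (hsub fun i hi => by rw [h i hi]; exact (hu i hi).2)
  have htail : Tendsto (fun M => ∑' i, if M ≤ i then a k i else 0) atTop (nhds 0) := by
    have := tendsto_tsum_of_dominated_convergence (𝓕 := atTop) (hs k)
      (f := fun M i => if M ≤ i then a k i else 0) (g := fun _ => 0)
      (fun i => tendsto_const_nhds.congr' ?_) (Eventually.of_forall fun M i => ?_)
    · simpa using this
    · filter_upwards [eventually_gt_atTop i] with M hM
      rw [if_neg (by omega)]
    · split_ifs <;> simp [abs_of_nonneg, ha]
  obtain ⟨N₁, hN₁⟩ := eventually_atTop.1 (htail.eventually_lt_const (half_pos hε))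
  refine ⟨k, max N₁ (I.sup id + 1), fun n hn M hM => ?_⟩
  have hI (i : ℕ) (hi : i ∈ I) : i < M := by
    have : i ≤ I.sup id := Finset.le_sup (f := id) hi
    have := le_of_max_le_right hM
    omega
  let S₁ : ℕ → Bool := fun i => if i < M then S₀ i else false
  let S₂ : ℕ → Bool := fun i => if i < M then S₀ i else true
  have h₁ : S₁ ∈ E k := hmem fun i hi => by simp [S₁, hI i hi]
  have h₂ : S₂ ∈ E k := hmem fun i hi => by simp [S₂, hI i hi]
  have hsplit (n : ℕ) : g n S₂ = g n S₁ + ∑' i, if M ≤ i then a n i else 0 := by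
    simp only [hg]
    rw [← (hsum n _).tsum_add (hsum n _)]
    refine tsum_congr fun i => ?_
    by_cases h : i < M
    · simp [S₁, S₂, h, not_le.2 h]
    · simp [S₁, S₂, h, not_lt.1 h]
  have h₁' : |g n S₁ - g k S₁| ≤ ε / 4 := Set.mem_iInter₂.1 h₁ n hn
  have h₂' : |g n S₂ - g k S₂| ≤ ε / 4 := Set.mem_iInter₂.1 h₂ n hn
  rw [abs_le] at h₁' h₂'
  have := hN₁ M (le_of_max_le_left hM)
  have e₁ := hsplit n
  have e₂ := hsplit k
  linarith [h₁'.1, h₁'.2, h₂'.1, h₂'.2]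

/-- **Vitali–Hahn–Saks / Nikodym**: a setwise limit of probability measures is a probability
measure. -/
lemma exists_measure_of_forall_tendsto_real {α : Type*} [MeasurableSpace α] (m : ℕ → Measure α)
    [∀ n, IsProbabilityMeasure (m n)]
    (h : ∀ F, MeasurableSet F → ∃ L : ℝ, Tendsto (fun n => (m n).real F) atTop (nhds L)) :
    ∃ m' : Measure α, IsProbabilityMeasure m' ∧
      ∀ F, MeasurableSet F → Tendsto (fun n => (m n).real F) atTop (nhds (m'.real F)) := by
  classical
  choose L hL using h
  have hL0 (F) (hF : MeasurableSet F) : 0 ≤ L F hF :=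
    ge_of_tendsto' (hL F hF) fun n => measureReal_nonneg
  have hempty : L ∅ .empty = 0 := tendsto_nhds_unique (hL ∅ .empty) (by simp)
  have hsum ⦃f : ℕ → Set α⦄ (hf : ∀ i, MeasurableSet (f i))
      (hd : Pairwise (Function.onFun Disjoint f)) :
      HasSum (fun i => L (f i) (hf i)) (L (⋃ i, f i) (.iUnion hf)) := by
    have hU (n : ℕ) (p : ℕ → Prop) [DecidablePred p] :
        HasSum (fun i => if p i then (m n).real (f i) else 0)
          ((m n).real (⋃ i, if p i then f i else ∅)) := by
      have hd' : Pairwise (Function.onFun Disjoint fun i => if p i then f i else ∅) := by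
        intro i j hij
        simp only [Function.onFun]
        split_ifs
        exacts [hd hij, Set.disjoint_empty _, Set.empty_disjoint _, Set.disjoint_empty _]
      have hm (i : ℕ) : MeasurableSet (if p i then f i else ∅) := by
        split_ifs
        exacts [hf i, .empty]
      have := ENNReal.hasSum_toReal (f := fun i => m n (if p i then f i else ∅))
        (by rw [← measure_iUnion hd' hm]; exact measure_ne_top _ _)
      rw [← ENNReal.tsum_toReal_eq fun i => measure_ne_top _ _, ← measure_iUnion hd' hm] at this
      convert this using 2 with i
      · split_ifs <;> simp [Measure.real]
      · rfl
    have hmU (p : ℕ → Prop) [DecidablePred p] :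
        MeasurableSet (⋃ i, if p i then f i else ∅) := .iUnion fun i => by
      split_ifs
      exacts [hf i, .empty]
    have hs (n : ℕ) : HasSum (fun i => (m n).real (f i)) ((m n).real (⋃ i, f i)) := by
      simpa using hU n fun _ => True
    rw [hasSum_iff_tendsto_nat_of_nonneg fun i => hL0 _ _]
    refine Metric.tendsto_atTop'.2 fun ε hε => ?_
    obtain ⟨k, N, hkN⟩ := exists_forall_tail_le_of_tendsto_tsum_ite
      (a := fun n i => (m n).real (f i)) (fun _ _ => measureReal_nonneg)
      (fun n => (hs n).summable)
      (fun S => ⟨_, (hL _ (hmU fun i => S i)).congr fun n => (hU n fun i => S i).tsum_eq.symm⟩)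
      (half_pos hε)
    refine ⟨N, fun M hM => ?_⟩
    have hsplit (n : ℕ) : (m n).real (⋃ i, f i) - ∑ i ∈ Finset.range M, (m n).real (f i) =
        ∑' i, if M ≤ i then (m n).real (f i) else 0 := by
      have h₁ := hasSum_sum_of_ne_finset_zero (s := Finset.range M)
        (f := fun i => if M ≤ i then 0 else (m n).real (f i)) (L := .unconditional ℕ)
        (fun i hi => by simpa using fun h => absurd hi (by simpa using h))
      have h₂ := (hs n).sub h₁
      rw [Finset.sum_congr rfl (g := fun i => (m n).real (f i))
        (fun i hi => if_neg (not_le.2 (Finset.mem_range.1 hi)))] at h₂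
      rw [← h₂.tsum_eq]
      refine tsum_congr fun i => ?_
      split_ifs <;> simp
    have hlim : Tendsto (fun n => (m n).real (⋃ i, f i) -
        ∑ i ∈ Finset.range M, (m n).real (f i)) atTop
        (nhds (L (⋃ i, f i) (.iUnion hf) - ∑ i ∈ Finset.range M, L (f i) (hf i))) :=
      (hL _ _).sub (tendsto_finsetSum _ fun i _ => hL _ _)
    have hle := le_of_tendsto hlim (eventually_atTop.2 ⟨k, fun n hn =>
      (hsplit n).trans_le (hkN n hn M hM.le)⟩)
    have hge := ge_of_tendsto' hlim fun n => by
      rw [hsplit]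
      exact tsum_nonneg fun i => by split_ifs <;> simp
    rw [Real.dist_eq, abs_sub_comm, abs_of_nonneg hge]
    linarith
  let m' : Measure α := Measure.ofMeasurable (fun F hF => ENNReal.ofReal (L F hF))
    (by simp [hempty]) fun f hf hd => by
      rw [← (hsum hf hd).tsum_eq]
      exact ENNReal.ofReal_tsum_of_nonneg (fun i => hL0 _ _) (hsum hf hd).summable
  have hm' (F) (hF : MeasurableSet F) : m' F = ENNReal.ofReal (L F hF) :=
    Measure.ofMeasurable_apply F hF
  refine ⟨m', ⟨?_⟩, fun F hF => ?_⟩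
  · rw [hm' _ .univ, tendsto_nhds_unique (hL _ .univ) (b := 1) (by simp)]
    simp
  · rw [Measure.real, hm' F hF, ENNReal.toReal_ofReal (hL0 F hF)]
    exact hL F hF

lemma Stationary.measurePreserving {α : Type*} [MeasurableSpace α] {T : α → α} {η : Measure α}
    (h : Stationary T η) (hT : Measurable T) : MeasurePreserving T η η :=
  ⟨hT, Measure.ext fun F hF => by rw [Measure.map_apply hT hF, h F hF]⟩

/-- Poincaré recurrence for measures dominated by a stationary one. -/
lemma Stationary.recurrent_of_absolutelyContinuous {α : Type*} [MeasurableSpace α] {T : α → α}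
    {η η' : Measure α} [IsFiniteMeasure η'] (h : Stationary T η') (hT : Measurable T)
    (hac : η ≪ η') : Recurrent T η := by
  intro F hF
  refine hac (measure_mono_null ?_
    ((h.measurePreserving hT).conservative.ae_mem_imp_frequently_image_mem hF.nullMeasurableSet))
  rintro x ⟨hx, hx'⟩ hfreq
  obtain ⟨n, hn, hn'⟩ := frequently_atTop.1 (hfreq hx) 1
  refine hx' (Set.mem_iUnion.2 ⟨n - 1, ?_⟩)
  rwa [Nat.sub_add_cancel hn]

/-- Measures dominated by a stationary one are asymptotically mean stationary. -/
lemma Stationary.isAMS_of_absolutelyContinuous {α : Type*} [MeasurableSpace α] {T : α → α}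
    {η η' : Measure α} [IsFiniteMeasure η] [IsFiniteMeasure η'] (h : Stationary T η')
    (hT : Measurable T) (hac : η ≪ η') : IsAMS T η := by
  intro F hF
  have hmp := h.measurePreserving hT
  let U : Lp ℝ 2 η' →L[ℝ] Lp ℝ 2 η' :=
    (Lp.compMeasurePreservingₗᵢ ℝ T hmp).toContinuousLinearMap
  let f : Lp ℝ 2 η' := indicatorConstLp 2 hF (measure_ne_top _ _) 1
  obtain ⟨P, hlim⟩ : ∃ P : Lp ℝ 2 η',
      Tendsto (fun n => birkhoffAverage ℝ U id n f)
        atTop (nhds P) :=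
    ⟨_, U.tendsto_birkhoffAverage_orthogonalProjection
      (LinearIsometry.norm_toContinuousLinearMap_le _) f⟩
  let A : ℕ → α → ℝ := fun n x =>
    (∑ k ∈ Finset.range n, ((T^[k]) ⁻¹' F).indicator (fun _ => (1 : ℝ)) x) / n
  have hA (n : ℕ) : (birkhoffAverage ℝ U id n f : Lp ℝ 2 η') =ᵐ[η'] A n := by
    have hU (k : ℕ) : U^[k] f =ᵐ[η'] ((T^[k]) ⁻¹' F).indicator fun _ => (1 : ℝ) := by
      have : U^[k] f = Lp.compMeasurePreserving T^[k] (hmp.iterate k) f := by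
        rw [← Lp.compMeasurePreserving_iterate]
        rfl
      rw [this, Lp.indicatorConstLp_compMeasurePreserving]
      exact indicatorConstLp_coeFn
    have hsum : ∀ᵐ x ∂η', ∀ k, U^[k] f x = ((T^[k]) ⁻¹' F).indicator (fun _ => (1 : ℝ)) x :=
      ae_all_iff.2 hU
    simp only [birkhoffAverage, birkhoffSum, id]
    filter_upwards [Lp.coeFn_smul (n : ℝ)⁻¹ (∑ k ∈ Finset.range n, U^[k] f),
      Lp.coeFn_finsetSum (Finset.range n) (fun k => U^[k] f), hsum] with x h₁ h₂ h₃
    simp only [h₁, Pi.smul_apply, h₂, Finset.sum_apply, h₃, A, smul_eq_mul, div_eq_inv_mul]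
  have hmF (k : ℕ) : MeasurableSet ((T^[k]) ⁻¹' F) := hT.iterate k hF
  have hint (n : ℕ) : ∫ x, A n x ∂η =
      (∑ k ∈ Finset.range n, (η ((T^[k]) ⁻¹' F)).toReal) / n := by
    simp only [A]
    rw [integral_div, integral_finsetSum _ fun k _ => (integrable_const 1).indicator (hmF k)]
    simp [integral_indicator (hmF _), Measure.real]
  have hAm (n : ℕ) : Measurable (A n) :=
    (Finset.measurable_fun_sum _ fun k _ => measurable_const.indicator (hmF k)).div_const _
  have hAb (n : ℕ) (x : α) : ‖A n x‖ ≤ 1 := by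
    have h0 (k : ℕ) : 0 ≤ ((T^[k]) ⁻¹' F).indicator (fun _ => (1 : ℝ)) x :=
      Set.indicator_nonneg (fun _ _ => zero_le_one) _
    have h1 : ∑ k ∈ Finset.range n, ((T^[k]) ⁻¹' F).indicator (fun _ => (1 : ℝ)) x ≤ n := by
      simpa using Finset.sum_le_card_nsmul (Finset.range n) _ (1 : ℝ) fun k _ =>
        Set.indicator_le_self' (f := fun _ => (1 : ℝ)) (fun _ _ => zero_le_one) x
    rw [Real.norm_of_nonneg (div_nonneg (Finset.sum_nonneg fun k _ => h0 k) n.cast_nonneg)]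
    exact div_le_one_of_le₀ h1 n.cast_nonneg
  refine ⟨∫ x, P x ∂η, ?_⟩
  simp only [← hint]
  refine tendsto_of_subseq_tendsto fun ns hns => ?_
  obtain ⟨ms, -, hms⟩ := (tendstoInMeasure_of_tendsto_Lp (hlim.comp hns)).exists_seq_tendsto_ae
  refine ⟨ms, tendsto_integral_of_dominated_convergence (fun _ => 1)
    (fun n => (hAm _).aestronglyMeasurable) (integrable_const 1)
    (fun n => .of_forall (hAb _)) ?_⟩
  filter_upwards [hac.ae_le hms, hac.ae_le (ae_all_iff.2 hA)] with x h₁ h₂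
  exact h₁.congr fun n => h₂ _

/-- The stationary mean of an AMS measure exists. -/
lemma IsAMS.exists_isStationaryMean {α : Type*} [MeasurableSpace α] {T : α → α}
    {η : Measure α} [IsProbabilityMeasure η] (h : IsAMS T η) (hT : Measurable T) :
    ∃ η' : Measure α, IsProbabilityMeasure η' ∧ IsStationaryMean T η η' := by
  let m : ℕ → Measure α := fun n =>
    ((n + 1 : ℕ) : ENNReal)⁻¹ • ∑ k ∈ Finset.range (n + 1), η.map T^[k]
  have hm (n : ℕ) (F : Set α) (hF : MeasurableSet F) : m n F =
      ((n + 1 : ℕ) : ENNReal)⁻¹ * ∑ k ∈ Finset.range (n + 1), η (T^[k] ⁻¹' F) := by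
    simp [m, Measure.map_apply (hT.iterate _) hF]
  have hprob (n : ℕ) : IsProbabilityMeasure (m n) := ⟨by
    rw [hm n _ .univ]
    simpa using ENNReal.inv_mul_cancel (a := (n : ENNReal) + 1) (by simp) (by finiteness)⟩
  have hreal (n : ℕ) (F : Set α) (hF : MeasurableSet F) : (m n).real F =
      (∑ k ∈ Finset.range (n + 1), (η (T^[k] ⁻¹' F)).toReal) / ((n + 1 : ℕ) : ℝ) := by
    rw [Measure.real, hm n F hF, ENNReal.toReal_mul, ENNReal.toReal_inv, ENNReal.toReal_natCast,
      ENNReal.toReal_sum fun k _ => measure_ne_top _ _, div_eq_inv_mul]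
  obtain ⟨η', hη', hlim⟩ := exists_measure_of_forall_tendsto_real m fun F hF => by
    obtain ⟨L, hL⟩ := h F hF
    refine ⟨L, ?_⟩
    simp only [hreal _ F hF]
    exact hL.comp (tendsto_add_atTop_nat 1)
  refine ⟨η', hη', fun F hF => ?_⟩
  have := hlim F hF
  simp only [hreal _ F hF] at this
  exact (tendsto_add_atTop_iff_nat 1).1 this

namespace IsStationaryMean

variable {α : Type*} [MeasurableSpace α] {T : α → α} {η η' : Measure α}

lemma stationary [IsProbabilityMeasure η] [IsProbabilityMeasure η'] (h : IsStationaryMean T η η')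
    (hT : Measurable T) : Stationary T η' := by
  intro F hF
  have h₁ := (h _ (hT hF)).sub (h F hF)
  have h₂ : Tendsto (fun n : ℕ => ((η (T^[n] ⁻¹' F)).toReal - (η F).toReal) / (n : ℝ)) atTop
      (nhds 0) := by
    refine squeeze_zero_norm (a := fun n : ℕ => 1 / (n : ℝ)) (fun n => ?_)
      tendsto_one_div_atTop_nhds_zero_nat
    rw [norm_div, Real.norm_natCast]
    gcongr
    have a₁ : (η (T^[n] ⁻¹' F)).toReal ≤ 1 := measureReal_le_one
    have a₂ : (η F).toReal ≤ 1 := measureReal_le_one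
    have a₃ : 0 ≤ (η (T^[n] ⁻¹' F)).toReal := ENNReal.toReal_nonneg
    have a₄ : 0 ≤ (η F).toReal := ENNReal.toReal_nonneg
    exact abs_le.2 ⟨by linarith, by linarith⟩
  have h₃ := tendsto_nhds_unique (h₁.congr fun n => ?_) h₂
  · exact (ENNReal.toReal_eq_toReal_iff' (measure_ne_top _ _) (measure_ne_top _ _)).1
      (sub_eq_zero.1 h₃)
  · rw [← sub_div, ← Finset.sum_sub_distrib]
    congr 1
    simp only [← Set.preimage_comp, ← Function.iterate_succ']
    exact Finset.sum_range_sub (fun k => (η (T^[k] ⁻¹' F)).toReal) n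

lemma apply_eq_of_forall_preimage [IsFiniteMeasure η] [IsFiniteMeasure η']
    (h : IsStationaryMean T η η') {F : Set α} (hF : MeasurableSet F)
    (hinv : ∀ k, η (T^[k] ⁻¹' F) = η F) : η' F = η F := by
  refine (ENNReal.toReal_eq_toReal_iff' (measure_ne_top _ _) (measure_ne_top _ _)).1
    (tendsto_nhds_unique (h F hF) (tendsto_const_nhds.congr' ?_))
  filter_upwards [eventually_ne_atTop 0] with n hn
  have : (n : ℝ) ≠ 0 := by exact_mod_cast hn
  simp [hinv, this]

/-- A recurrent AMS measure is dominated by its stationary mean. -/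
lemma absolutelyContinuous [IsProbabilityMeasure η] [IsProbabilityMeasure η']
    (h : IsStationaryMean T η η') (hT : Measurable T) (hrec : Recurrent T η) : η ≪ η' := by
  refine Measure.AbsolutelyContinuous.mk fun F hF hF0 => ?_
  have hmF (k : ℕ) : MeasurableSet ((T^[k]) ⁻¹' F) := hT.iterate k hF
  set G : Set α := limsup (fun k => (T^[k]) ⁻¹' F) atTop with hG
  have hmemG (x : α) : x ∈ G ↔ ∃ᶠ k in atTop, T^[k] x ∈ F := by
    rw [hG, mem_limsup_iff_frequently_mem]
    rfl
  have hGm : MeasurableSet G := MeasurableSet.measurableSet_limsup hmF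
  have hGinv : T ⁻¹' G = G := by
    ext x
    rw [Set.mem_preimage, hmemG, hmemG]
    conv_rhs => rw [← map_add_atTop_eq_nat 1, frequently_map]
    rfl
  have hGinv' (k : ℕ) : T^[k] ⁻¹' G = G := by
    induction k with
    | zero => rfl
    | succ k ih => rw [Function.iterate_succ, Set.preimage_comp, ih, hGinv]
  have hG0 : η G = 0 := by
    rw [← h.apply_eq_of_forall_preimage hGm fun k => by rw [hGinv']]
    refine measure_mono_null (t := ⋃ k, T^[k] ⁻¹' F) (fun x hx => ?_)
      (measure_iUnion_null fun k => ?_)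
    · obtain ⟨k, hk⟩ := ((hmemG x).1 hx).exists
      exact Set.mem_iUnion.2 ⟨k, hk⟩
    · rw [(((h.stationary hT).measurePreserving hT).iterate k).measure_preimage
        hF.nullMeasurableSet, hF0]
  set W : Set α := F \ ⋃ k : ℕ, (T^[k + 1]) ⁻¹' F with hW
  have hWm : MeasurableSet W := hF.diff (.iUnion fun k => hmF _)
  have hW0 (n : ℕ) : η (T^[n] ⁻¹' W) = 0 := by
    rw [← hrec _ (hT.iterate n hWm)]
    congr 1
    refine (sdiff_eq_left.2 (Set.disjoint_left.2 fun x hx hx' => ?_)).symm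
    obtain ⟨k, hk⟩ := Set.mem_iUnion.1 hx'
    refine hx.2 (Set.mem_iUnion.2 ⟨k, ?_⟩)
    have : T^[n] (T^[k + 1] x) ∈ F := hk.1
    rwa [← Function.iterate_add_apply, add_comm, Function.iterate_add_apply] at this
  refine measure_mono_null (t := G ∪ ⋃ n, T^[n] ⁻¹' W) (fun x hx => ?_)
    (measure_union_null hG0 (measure_iUnion_null hW0))
  by_contra! hcon
  rw [Set.mem_union, not_or, hmemG, Set.mem_iUnion, not_exists] at hcon
  obtain ⟨hcon, hcon'⟩ := hcon
  refine hcon (frequently_atTop.2 fun N => ?_)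
  induction N with
  | zero => exact ⟨0, le_rfl, hx⟩
  | succ N ih =>
    obtain ⟨n, hn, hnF⟩ := ih
    have := hcon' n
    rw [Set.mem_preimage, hW, Set.mem_sdiff, not_and_not_right] at this
    obtain ⟨k, hk⟩ := Set.mem_iUnion.1 (this hnF)
    refine ⟨k + 1 + n, by omega, ?_⟩
    rw [Function.iterate_add_apply]
    exact hk

end IsStationaryMean

theorem stmt5 {A B : Type*} [MeasurableSpace A] [MeasurableSpace B]
    [StandardBorelSpace A] [StandardBorelSpace B]
    (TA : A → A) (TB : B → B) (hTA : Measurable TA) (hTB : Measurable TB)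
    (ν : Kernel A B) [IsMarkovKernel ν] :
    (∀ (μ : Measure A) [IsProbabilityMeasure μ], Stationary TA μ →
        Recurrent (Prod.map TA TB) (μ ⊗ₘ ν) ∧ IsAMS (Prod.map TA TB) (μ ⊗ₘ ν)) ↔
      (∀ (μ : Measure A) [IsProbabilityMeasure μ], Stationary TA μ →
        ∃ νbar : Kernel A B, IsMarkovKernel νbar ∧
          Stationary (Prod.map TA TB) (μ ⊗ₘ νbar) ∧
          ∀ᵐ x ∂μ, ν x ≪ νbar x) := by
  have hT : Measurable (Prod.map TA TB) := hTA.prodMap hTB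
  refine ⟨fun h μ _ hμ => ?_, fun h μ _ hμ => ?_⟩
  · obtain ⟨hrec, hams⟩ := h μ hμ
    obtain ⟨η', _, hη'⟩ := hams.exists_isStationaryMean hT
    have hfst : η'.fst = μ := by
      ext F hF
      have hpre (k : ℕ) : (μ ⊗ₘ ν) ((Prod.map TA TB)^[k] ⁻¹' (Prod.fst ⁻¹' F)) = μ F := by
        rw [← Set.preimage_comp, Prod.map_iterate, Prod.map_fst', Set.preimage_comp,
          ← Measure.fst_apply (hTA.iterate k hF), Measure.fst_compProd]
        exact ((hμ.measurePreserving hTA).iterate k).measure_preimage hF.nullMeasurableSet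
      rw [Measure.fst_apply hF, hη'.apply_eq_of_forall_preimage (measurable_fst hF)
        fun k => (hpre k).trans (hpre 0).symm]
      exact hpre 0
    have : Nonempty A := nonempty_of_isProbabilityMeasure μ
    have : Nonempty B := nonempty_of_isProbabilityMeasure (ν (Classical.arbitrary A))
    have hdis : μ ⊗ₘ η'.condKernel = η' := by
      conv_lhs => rw [← hfst]
      exact η'.disintegrate η'.condKernel
    refine ⟨η'.condKernel, inferInstance, ?_, ?_⟩
    · rw [hdis]
      exact hη'.stationary hT
    · refine Measure.AbsolutelyContinuous.kernel_of_compProd (ν := μ) ?_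
      rw [hdis]
      exact hη'.absolutelyContinuous hT hrec
  · obtain ⟨νbar, _, hstat, hac⟩ := h μ hμ
    have hac' : μ ⊗ₘ ν ≪ μ ⊗ₘ νbar := .compProd_right hac
    exact ⟨hstat.recurrent_of_absolutelyContinuous hT hac',
      hstat.isAMS_of_absolutelyContinuous hT hac'⟩
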